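/- Let p be an odd prime, let f : ℤ_p → ℤ_p be everywhere analytic with integral coefficients, let λ, u ∈ ℚ_p with ‖λ‖_p > 1 and ‖u‖_p < ‖λ‖_p, and let s ∈ ℤ_p with s ≠ 1. Then all Volkenborn integrals B_n^f(u) := ∫_{ℤ_p} (u+f(a))^n da exist, the series Σ_{n=0}^∞ C(1−s,n)·B_n^f(u)·λ^{−n} converges, and ζ_p^f(s,λ+u) = (s−1)^{−1}·⟨λ⟩^{1−s}·Σ_{n=0}^∞ C(1−s,n)·B_n^f(u)·λ^{−n}. -/

import Mathlib

open Filter Topology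

namespace PZeta

variable (p : ℕ) [Fact p.Prime]

/-- The `N`-th partial sum defining the fermionic integral
`∫_{ℤ_p} g dμ₋₁ = lim_N Σ_{a=0}^{p^N-1} (-1)^a g(a)`. -/
noncomputable def fermSum (g : ℤ_[p] → ℚ_[p]) (N : ℕ) : ℚ_[p] :=
  ∑ a ∈ Finset.range (p ^ N), (-1 : ℚ_[p]) ^ a * g (a : ℤ_[p])

/-- The `N`-th partial sum defining the Volkenborn integral
`∫_{ℤ_p} g da = lim_N p^{-N} Σ_{a=0}^{p^N-1} g(a)`. -/
noncomputable def volkSum (g : ℤ_[p] → ℚ_[p]) (N : ℕ) : ℚ_[p] :=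
  ((p : ℚ_[p]) ^ N)⁻¹ * ∑ a ∈ Finset.range (p ^ N), g (a : ℤ_[p])

/-- The unit part `x·p^{-v_p(x)}` of a nonzero `p`-adic number. -/
noncomputable def unitPart (x : ℚ_[p]) : ℚ_[p] := x * (p : ℚ_[p]) ^ (-x.valuation)

/-- The Teichmüller representative of a `p`-adic unit, `lim_n x^{p^n}`. -/
noncomputable def teich (x : ℚ_[p]) : ℚ_[p] :=
  limUnder atTop fun n : ℕ => x ^ p ^ n

/-- The projection `⟨x⟩ ∈ 1 + pℤ_p`, via `x = p^{v_p(x)}·ζ·⟨x⟩`. -/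
noncomputable def angle (x : ℚ_[p]) : ℚ_[p] := unitPart p x / teich p (unitPart p x)

/-- `ω_v(x) := x / ⟨x⟩ = p^{v_p(x)}·ζ`. -/
noncomputable def omegaV (x : ℚ_[p]) : ℚ_[p] := x / angle p x

/-- The generalized binomial coefficient `C(t,n) = t(t-1)⋯(t-n+1)/n!`. -/
noncomputable def gbinom (t : ℚ_[p]) (n : ℕ) : ℚ_[p] :=
  (∏ i ∈ Finset.range n, (t - (i : ℚ_[p]))) / (n.factorial : ℚ_[p])

/-- The power `y^t` defined by the binomial series `Σ_n C(t,n)(y-1)^n`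
(used for `y ∈ 1 + pℤ_p` and `t ∈ ℤ_p`). -/
noncomputable def bpow (y t : ℚ_[p]) : ℚ_[p] := ∑' n : ℕ, gbinom p t n * (y - 1) ^ n

/-- The Iwasawa `p`-adic logarithm: `log_p x = Σ_{n≥1} (-1)^{n+1}(⟨x⟩-1)^n/n`
(one has `log_p p = 0` and `log_p ζ = 0` for roots of unity of order prime to `p`). -/
noncomputable def padicLog (x : ℚ_[p]) : ℚ_[p] :=
  ∑' n : ℕ, (-1 : ℚ_[p]) ^ n * (angle p x - 1) ^ (n + 1) / ((n : ℚ_[p]) + 1)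

/-- The power `y^t` defined by the exponential series `Σ_n (t·log_p y)^n/n!`
(used for `y ∈ 1 + pℤ_p` and `‖t‖ < p^{(p-2)/(p-1)}`). -/
noncomputable def epow (y t : ℚ_[p]) : ℚ_[p] :=
  ∑' n : ℕ, (t * padicLog p y) ^ n / (n.factorial : ℚ_[p])

/-- `f : ℤ_p → ℤ_p` is everywhere analytic with integral coefficients:
`f(x) = Σ_k c_k x^k` with `‖c_k‖ ≤ 1`, `c_k → 0`. -/
def EverywhereAnalytic (f : ℤ_[p] → ℤ_[p]) : Prop :=
  ∃ c : ℕ → ℚ_[p], (∀ k, ‖c k‖ ≤ 1) ∧ Tendsto c atTop (𝓝 0) ∧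
    ∀ x : ℤ_[p], (f x : ℚ_[p]) = ∑' k : ℕ, c k * (x : ℚ_[p]) ^ k

/-- The `p`-adic Hurwitz-type Euler zeta function w.r.t. `f`:
`ζ_{p,E}^f(s,λ) = ∫_{ℤ_p} ⟨λ+f(a)⟩^{1-s} dμ₋₁(a)`. -/
noncomputable def zetaE (f : ℤ_[p] → ℤ_[p]) (s : ℤ_[p]) (lam : ℚ_[p]) : ℚ_[p] :=
  limUnder atTop
    (fermSum p fun a => bpow p (angle p (lam + (f a : ℚ_[p]))) (1 - (s : ℚ_[p])))

/-- The `p`-adic Hurwitz zeta function w.r.t. `f`: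
`ζ_p^f(s,λ) = (s-1)⁻¹ ∫_{ℤ_p} ⟨λ+f(a)⟩^{1-s} da`. -/
noncomputable def zetaH (f : ℤ_[p] → ℤ_[p]) (s : ℤ_[p]) (lam : ℚ_[p]) : ℚ_[p] :=
  ((s : ℚ_[p]) - 1)⁻¹ *
    limUnder atTop
      (volkSum p fun a => bpow p (angle p (lam + (f a : ℚ_[p]))) (1 - (s : ℚ_[p])))

end PZeta

namespace PZeta

variable {p : ℕ} [Fact p.Prime]

private lemma norm_add_le_of_le {a b : ℚ_[p]} {C : ℝ} (ha : ‖a‖ ≤ C) (hb : ‖b‖ ≤ C) :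
    ‖a + b‖ ≤ C :=
  (IsUltrametricDist.norm_add_le_max a b).trans (max_le ha hb)

private lemma norm_mul_le_of_le {a b : ℚ_[p]} {A B : ℝ} (ha : ‖a‖ ≤ A) (hb : ‖b‖ ≤ B) :
    ‖a * b‖ ≤ A * B := by
  rw [norm_mul]
  exact mul_le_mul ha hb (norm_nonneg _) ((norm_nonneg _).trans ha)

private lemma norm_tsum_le_of_forall {g : ℕ → ℚ_[p]} {C : ℝ} (h : ∀ k, ‖g k‖ ≤ C) :
    ‖∑' k, g k‖ ≤ C :=
  (IsUltrametricDist.norm_tsum_le g).trans (ciSup_le h)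

/-- `g` has a first-order Taylor expansion with derivative `d`, with all the terms and the
remainder controlled by the constant `C`. -/
structure TaylorBound (C : ℝ) (g d : ℤ_[p] → ℚ_[p]) : Prop where
  norm_le : ∀ x, ‖g x‖ ≤ C
  norm_deriv_le : ∀ x, ‖d x‖ ≤ C
  remainder : ∀ x h : ℤ_[p], ‖g (x + h) - g x - h * d x‖ ≤ C * ‖h‖ ^ 2
  deriv_lipschitz : ∀ x h : ℤ_[p], ‖d (x + h) - d x‖ ≤ C * ‖h‖

namespace TaylorBound

variable {C C₁ C₂ : ℝ} {g d g₁ d₁ g₂ d₂ : ℤ_[p] → ℚ_[p]}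

lemma nonneg (H : TaylorBound C g d) : 0 ≤ C := (norm_nonneg _).trans (H.norm_le 0)

lemma mono (H : TaylorBound C₁ g d) (h : C₁ ≤ C₂) : TaylorBound C₂ g d where
  norm_le x := (H.norm_le x).trans h
  norm_deriv_le x := (H.norm_deriv_le x).trans h
  remainder x y := (H.remainder x y).trans (by gcongr)
  deriv_lipschitz x y := (H.deriv_lipschitz x y).trans (by gcongr)

lemma const (c : ℚ_[p]) : TaylorBound ‖c‖ (fun _ => c) 0 where
  norm_le _ := le_rfl
  norm_deriv_le _ := by simp
  remainder _ _ := by simp; positivity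
  deriv_lipschitz _ _ := by simp; positivity

lemma coe : TaylorBound 1 (fun x : ℤ_[p] => (x : ℚ_[p])) 1 where
  norm_le x := x.2
  norm_deriv_le _ := by simp
  remainder _ _ := by simp
  deriv_lipschitz _ _ := by simp

lemma add (H₁ : TaylorBound C g₁ d₁) (H₂ : TaylorBound C g₂ d₂) :
    TaylorBound C (fun x => g₁ x + g₂ x) (fun x => d₁ x + d₂ x) where
  norm_le x := norm_add_le_of_le (H₁.norm_le x) (H₂.norm_le x)
  norm_deriv_le x := norm_add_le_of_le (H₁.norm_deriv_le x) (H₂.norm_deriv_le x)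
  remainder x h := by
    convert norm_add_le_of_le (H₁.remainder x h) (H₂.remainder x h) using 2
    ring
  deriv_lipschitz x h := by
    convert norm_add_le_of_le (H₁.deriv_lipschitz x h) (H₂.deriv_lipschitz x h) using 2
    ring

lemma lipschitz (H : TaylorBound C g d) (x h : ℤ_[p]) : ‖g (x + h) - g x‖ ≤ C * ‖h‖ := by
  have hC := H.nonneg
  have h1 : ‖g (x + h) - g x - h * d x‖ ≤ C * ‖h‖ :=
    (H.remainder x h).trans <| by
      gcongr
      nlinarith [h.norm_le_one, norm_nonneg h]
  have h2 : ‖(h : ℚ_[p]) * d x‖ ≤ C * ‖h‖ := by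
    rw [mul_comm C]
    exact norm_mul_le_of_le le_rfl (H.norm_deriv_le x)
  convert norm_add_le_of_le h1 h2 using 2
  ring

lemma mul (H₁ : TaylorBound C₁ g₁ d₁) (H₂ : TaylorBound C₂ g₂ d₂) :
    TaylorBound (C₁ * C₂) (fun x => g₁ x * g₂ x) (fun x => d₁ x * g₂ x + g₁ x * d₂ x) where
  norm_le x := norm_mul_le_of_le (H₁.norm_le x) (H₂.norm_le x)
  norm_deriv_le x :=
    norm_add_le_of_le (norm_mul_le_of_le (H₁.norm_deriv_le x) (H₂.norm_le x))
      (norm_mul_le_of_le (H₁.norm_le x) (H₂.norm_deriv_le x))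
  remainder x h := by
    have h1 := norm_mul_le_of_le (H₁.norm_le (x + h)) (H₂.remainder x h)
    have h2 := norm_mul_le_of_le (H₁.remainder x h) (H₂.norm_le x)
    have h3 := norm_mul_le_of_le (norm_mul_le_of_le (le_refl ‖(h : ℚ_[p])‖) (H₂.norm_deriv_le x))
      (H₁.lipschitz x h)
    rw [← PadicInt.norm_def] at h3
    rw [show C₁ * (C₂ * ‖h‖ ^ 2) = C₁ * C₂ * ‖h‖ ^ 2 by ring] at h1
    rw [show C₁ * ‖h‖ ^ 2 * C₂ = C₁ * C₂ * ‖h‖ ^ 2 by ring] at h2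
    rw [show ‖h‖ * C₂ * (C₁ * ‖h‖) = C₁ * C₂ * ‖h‖ ^ 2 by ring] at h3
    convert norm_add_le_of_le (norm_add_le_of_le h1 h2) h3 using 2
    ring
  deriv_lipschitz x h := by
    have h1 := norm_mul_le_of_le (H₁.deriv_lipschitz x h) (H₂.norm_le (x + h))
    have h2 := norm_mul_le_of_le (H₁.norm_deriv_le x) (H₂.lipschitz x h)
    have h3 := norm_mul_le_of_le (H₁.lipschitz x h) (H₂.norm_deriv_le (x + h))
    have h4 := norm_mul_le_of_le (H₁.norm_le x) (H₂.deriv_lipschitz x h)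
    rw [show C₁ * ‖h‖ * C₂ = C₁ * C₂ * ‖h‖ by ring] at h1 h3
    rw [← mul_assoc] at h2 h4
    convert norm_add_le_of_le (norm_add_le_of_le h1 h2) (norm_add_le_of_le h3 h4) using 2
    ring

lemma exists_pow (H : TaylorBound C g d) (n : ℕ) :
    ∃ e, TaylorBound (C ^ n) (fun x => g x ^ n) e := by
  induction n with
  | zero => exact ⟨0, by simpa using const (1 : ℚ_[p])⟩
  | succ n ih =>
    obtain ⟨e, he⟩ := ih
    exact ⟨_, by simpa only [pow_succ] using he.mul H⟩

lemma tsum {c : ℕ → ℝ} {G D : ℕ → ℤ_[p] → ℚ_[p]} (H : ∀ k, TaylorBound (c k) (G k) (D k))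
    (hc : ∀ k, c k ≤ C) (hc0 : Tendsto c atTop (𝓝 0)) :
    TaylorBound C (fun x => ∑' k, G k x) (fun x => ∑' k, D k x) := by
  have summable_of_le {F : ℕ → ℚ_[p]} (hF : ∀ k, ‖F k‖ ≤ c k) : Summable F := by
    apply NonarchimedeanAddGroup.summable_of_tendsto_cofinite_zero
    rw [Nat.cofinite_eq_atTop]
    exact squeeze_zero_norm hF hc0
  have sG (x) : Summable fun k => G k x := summable_of_le fun k => (H k).norm_le x
  have sD (x) : Summable fun k => D k x := summable_of_le fun k => (H k).norm_deriv_le x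
  exact
  { norm_le x := norm_tsum_le_of_forall fun k => ((H k).mono (hc k)).norm_le x
    norm_deriv_le x := norm_tsum_le_of_forall fun k => ((H k).mono (hc k)).norm_deriv_le x
    remainder x h := by
      rw [← tsum_mul_left, ← (sG _).tsum_sub (sG _),
        ← ((sG _).sub (sG _)).tsum_sub ((sD x).mul_left _)]
      exact norm_tsum_le_of_forall fun k => ((H k).mono (hc k)).remainder x h
    deriv_lipschitz x h := by
      rw [← (sD _).tsum_sub (sD _)]
      exact norm_tsum_le_of_forall fun k => ((H k).mono (hc k)).deriv_lipschitz x h }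

end TaylorBound

lemma EverywhereAnalytic.exists_taylorBound {f : ℤ_[p] → ℤ_[p]} (hf : EverywhereAnalytic p f) :
    ∃ d, TaylorBound 1 (fun x => (f x : ℚ_[p])) d := by
  obtain ⟨c, hc1, hc0, hfc⟩ := hf
  choose e he using (TaylorBound.coe (p := p)).exists_pow
  have H (k) := (TaylorBound.const (c k)).mul (he k)
  simp only [one_pow, mul_one] at H
  simp only [hfc]
  exact ⟨_, TaylorBound.tsum H hc1 (tendsto_zero_iff_norm_tendsto_zero.1 hc0)⟩

private lemma sum_range_mul {M : Type*} [AddCommMonoid M] (g : ℕ → M) (m n : ℕ) :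
    ∑ a ∈ Finset.range (m * n), g a =
      ∑ b ∈ Finset.range n, ∑ a ∈ Finset.range m, g (a + m * b) := by
  induction n with
  | zero => simp
  | succ n ih =>
    rw [Nat.mul_succ, Finset.sum_range_add, Finset.sum_range_succ, ih]
    simp only [add_comm (m * n)]

private lemma norm_sum_le_of_forall {ι : Type*} {t : Finset ι} {g : ι → ℚ_[p]} {C : ℝ}
    (hC : 0 ≤ C) (h : ∀ i ∈ t, ‖g i‖ ≤ C) : ‖∑ i ∈ t, g i‖ ≤ C :=
  IsUltrametricDist.norm_sum_le_of_forall_le_of_nonneg hC h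

private lemma norm_natCast_prime_pow_mul_le (N b : ℕ) :
    ‖(((p ^ N * b : ℕ) : ℤ_[p]))‖ ≤ ((p : ℝ)⁻¹) ^ N := by
  push_cast
  rw [norm_mul, norm_pow, PadicInt.norm_p]
  exact mul_le_of_le_one_right (by positivity) (PadicInt.norm_le_one _)

/-- For odd `p`, the sum `0 + 1 + ⋯ + (p - 1)` is divisible by `p`. -/
private lemma norm_sum_range_prime_le (hp : Odd p) :
    ‖∑ b ∈ Finset.range p, (b : ℚ_[p])‖ ≤ (p : ℝ)⁻¹ := by
  obtain ⟨k, hk⟩ := hp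
  have h : ∑ b ∈ Finset.range p, b = p * k := by
    have := Finset.sum_range_id_mul_two p
    have h2 : p - 1 = k * 2 := by omega
    rw [h2, ← mul_assoc] at this
    exact Nat.eq_of_mul_eq_mul_right two_pos this
  rw [← Nat.cast_sum, h, Nat.cast_mul, norm_mul, Padic.norm_p]
  refine mul_le_of_le_one_right (by positivity) ?_
  exact_mod_cast Padic.norm_int_le_one (p := p) k

namespace TaylorBound

variable {C : ℝ} {g d : ℤ_[p] → ℚ_[p]}

lemma norm_sum_deriv_le (H : TaylorBound C g d) (N : ℕ) :
    ‖∑ a ∈ Finset.range (p ^ N), d (a : ℤ_[p])‖ ≤ C * p * ((p : ℝ)⁻¹) ^ N := by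
  have hC := H.nonneg
  have hp1 : (1 : ℝ) ≤ p := mod_cast (Fact.out : p.Prime).one_le
  induction N with
  | zero =>
    simpa using (H.norm_deriv_le 0).trans (le_mul_of_one_le_right hC hp1)
  | succ N ih =>
    have hp0 : (p : ℝ) ≠ 0 := by positivity
    have key : ∑ a ∈ Finset.range (p ^ (N + 1)), d (a : ℤ_[p]) =
        ∑ b ∈ Finset.range p, ∑ a ∈ Finset.range (p ^ N),
            (d ((a : ℤ_[p]) + (p ^ N * b : ℕ)) - d a) +
          p * ∑ a ∈ Finset.range (p ^ N), d (a : ℤ_[p]) := by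
      rw [pow_succ, sum_range_mul]
      simp only [Finset.sum_sub_distrib, Finset.sum_const, Finset.card_range, nsmul_eq_mul,
        Nat.cast_add]
      ring
    have e : C * p * ((p : ℝ)⁻¹) ^ (N + 1) = C * ((p : ℝ)⁻¹) ^ N := by
      rw [pow_succ]; field_simp
    rw [key, e]
    refine norm_add_le_of_le (norm_sum_le_of_forall (by positivity) fun b _ =>
      norm_sum_le_of_forall (by positivity) fun a _ => ?_) ?_
    · exact (H.deriv_lipschitz _ _).trans (by gcongr; exact norm_natCast_prime_pow_mul_le N b)
    · refine (norm_mul_le_of_le (Padic.norm_p (p := p)).le ih).trans (le_of_eq ?_)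
      field_simp

lemma norm_volkSum_succ_sub_le (hp : Odd p) (H : TaylorBound C g d) (N : ℕ) :
    ‖volkSum p g (N + 1) - volkSum p g N‖ ≤ C * p * ((p : ℝ)⁻¹) ^ N := by
  have hC := H.nonneg
  have hp1 : (1 : ℝ) ≤ p := mod_cast (Fact.out : p.Prime).one_le
  have hp0 : (p : ℝ) ≠ 0 := by positivity
  have hpQ : (p : ℚ_[p]) ≠ 0 := mod_cast (Fact.out : p.Prime).ne_zero
  have key : volkSum p g (N + 1) - volkSum p g N = ((p : ℚ_[p]) ^ (N + 1))⁻¹ *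
      (∑ b ∈ Finset.range p, ∑ a ∈ Finset.range (p ^ N),
        (g ((a : ℤ_[p]) + (p ^ N * b : ℕ)) - g a - ((p ^ N * b : ℕ) : ℤ_[p]) * d a) +
       p ^ N * ((∑ b ∈ Finset.range p, (b : ℚ_[p])) *
        ∑ a ∈ Finset.range (p ^ N), d (a : ℤ_[p]))) := by
    have e : (p : ℚ_[p]) ^ N * ((∑ b ∈ Finset.range p, (b : ℚ_[p])) *
        ∑ a ∈ Finset.range (p ^ N), d (a : ℤ_[p])) =
        ∑ b ∈ Finset.range p, ∑ a ∈ Finset.range (p ^ N),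
          (((p ^ N * b : ℕ) : ℤ_[p]) : ℚ_[p]) * d a := by
      rw [Finset.sum_mul, Finset.mul_sum]
      refine Finset.sum_congr rfl fun b _ => ?_
      rw [← Finset.mul_sum]
      push_cast
      ring
    rw [e, ← Finset.sum_add_distrib]
    simp only [← Finset.sum_add_distrib, sub_add_cancel]
    rw [volkSum, volkSum, pow_succ p N, sum_range_mul]
    simp only [Finset.sum_sub_distrib, Finset.sum_const, Finset.card_range, nsmul_eq_mul,
        Nat.cast_add]
    push_cast
    field_simp
    ring
  have hR : ‖∑ b ∈ Finset.range p, ∑ a ∈ Finset.range (p ^ N),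
        (g ((a : ℤ_[p]) + (p ^ N * b : ℕ)) - g a - ((p ^ N * b : ℕ) : ℤ_[p]) * d a)‖ ≤
      C * (((p : ℝ)⁻¹) ^ N) ^ 2 :=
    norm_sum_le_of_forall (by positivity) fun b _ =>
      norm_sum_le_of_forall (by positivity) fun a _ =>
        (H.remainder _ _).trans (by gcongr; exact norm_natCast_prime_pow_mul_le N b)
  have hD : ‖(p : ℚ_[p]) ^ N * ((∑ b ∈ Finset.range p, (b : ℚ_[p])) *
        ∑ a ∈ Finset.range (p ^ N), d (a : ℤ_[p]))‖ ≤ C * (((p : ℝ)⁻¹) ^ N) ^ 2 := by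
    refine (norm_mul_le_of_le (show ‖(p : ℚ_[p]) ^ N‖ ≤ ((p : ℝ)⁻¹) ^ N by
      rw [norm_pow, Padic.norm_p]) (norm_mul_le_of_le (norm_sum_range_prime_le hp)
        (H.norm_sum_deriv_le N))).trans (le_of_eq ?_)
    field_simp
  rw [key, norm_mul, norm_inv, norm_pow, Padic.norm_p]
  calc _ ≤ (((p : ℝ)⁻¹) ^ (N + 1))⁻¹ * (C * (((p : ℝ)⁻¹) ^ N) ^ 2) := by
        gcongr; exact norm_add_le_of_le hR hD
    _ = _ := by rw [pow_succ]; field_simp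

lemma norm_volkSum_le (hp : Odd p) (H : TaylorBound C g d) (N : ℕ) :
    ‖volkSum p g N‖ ≤ C * p := by
  have hC := H.nonneg
  have hp1 : (1 : ℝ) ≤ p := mod_cast (Fact.out : p.Prime).one_le
  induction N with
  | zero =>
    simpa [volkSum] using (H.norm_le 0).trans (le_mul_of_one_le_right hC hp1)
  | succ N ih =>
    have h := (H.norm_volkSum_succ_sub_le hp N).trans
      (mul_le_of_le_one_right (by positivity)
        (pow_le_one₀ (by positivity) (inv_le_one_of_one_le₀ hp1)))
    simpa using norm_add_le_of_le h ih

lemma exists_tendsto_volkSum (hp : Odd p) (H : TaylorBound C g d) :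
    ∃ B, Tendsto (volkSum p g) atTop (𝓝 B) := by
  refine cauchySeq_tendsto_of_complete
    (cauchySeq_of_le_geometric ((p : ℝ)⁻¹) (C * p) ?_ fun N => ?_)
  · exact inv_lt_one_of_one_lt₀ (mod_cast (Fact.out : p.Prime).one_lt)
  · rw [dist_comm, dist_eq_norm]
    exact H.norm_volkSum_succ_sub_le hp N

end TaylorBound

lemma gbinom_eq_coe_choose (t : ℤ_[p]) (n : ℕ) :
    gbinom p (t : ℚ_[p]) n = (Ring.choose t n : ℤ_[p]) := by
  have h := Ring.descPochhammer_eq_factorial_smul_choose t n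
  rw [Polynomial.descPochhammer_smeval_eq_ascPochhammer, Polynomial.ascPochhammer_smeval_eq_eval,
    ← descPochhammer_eval_eq_ascPochhammer, descPochhammer_eval_eq_prod_range, nsmul_eq_mul] at h
  have h' := congrArg (PadicInt.Coe.ringHom (p := p)) h
  simp only [map_prod, map_sub, map_mul, map_natCast] at h'
  rw [gbinom, div_eq_iff (mod_cast n.factorial_ne_zero), mul_comm]
  exact h'

private instance isBoundedSMul_padic : IsBoundedSMul ℤ_[p] ℚ_[p] :=
  .of_norm_smul_le fun r x => by
    rw [Algebra.smul_def, norm_mul, PadicInt.algebraMap_apply, PadicInt.norm_def]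

lemma norm_gbinom_le_one (t : ℤ_[p]) (n : ℕ) : ‖gbinom p (t : ℚ_[p]) n‖ ≤ 1 := by
  rw [gbinom_eq_coe_choose]
  exact PadicInt.norm_le_one _

lemma bpow_eq_addChar {r : ℚ_[p]} (hr : Tendsto (r ^ ·) atTop (𝓝 0)) (t : ℤ_[p]) :
    bpow p (1 + r) (t : ℚ_[p]) = PadicInt.addChar_of_value_at_one r hr t := by
  rw [PadicInt.coe_addChar_of_value_at_one, PadicInt.mahlerSeries_apply hr, bpow]
  refine tsum_congr fun n => ?_
  rw [gbinom_eq_coe_choose, add_sub_cancel_left, mahler_apply, Algebra.smul_def,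
    PadicInt.algebraMap_apply]

lemma bpow_mul {x y : ℚ_[p]} (hx : ‖x - 1‖ < 1) (hy : ‖y - 1‖ < 1) (t : ℤ_[p]) :
    bpow p (x * y) (t : ℚ_[p]) = bpow p x t * bpow p y t := by
  have tend {z : ℚ_[p]} (hz : ‖z - 1‖ < 1) : Tendsto ((z - 1) ^ ·) atTop (𝓝 0) :=
    tendsto_pow_atTop_nhds_zero_iff_norm_lt_one.2 hz
  have hxy : ‖x * y - 1‖ < 1 := by
    have h : x * y - 1 = (x - 1) * (y - 1) + ((x - 1) + (y - 1)) := by ring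
    rw [h]
    refine (IsUltrametricDist.norm_add_le_max _ _).trans_lt (max_lt ?_
      ((IsUltrametricDist.norm_add_le_max _ _).trans_lt (max_lt hx hy)))
    rw [norm_mul]
    exact mul_lt_one_of_nonneg_of_lt_one_left (norm_nonneg _) hx hy.le
  have e {z : ℚ_[p]} (hz : ‖z - 1‖ < 1) :
      bpow p z (t : ℚ_[p]) = PadicInt.addChar_of_value_at_one (z - 1) (tend hz) t := by
    rw [← bpow_eq_addChar (tend hz), add_sub_cancel]
  rw [e hx, e hy, e hxy, ← AddChar.mul_apply]
  congr 1
  refine (PadicInt.eq_addChar_of_value_at_one _ ?_ ?_).symm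
  · simp only [AddChar.coe_mul]
    exact (PadicInt.continuous_addChar_of_value_at_one _).mul
      (PadicInt.continuous_addChar_of_value_at_one _)
  · simp only [AddChar.mul_apply, PadicInt.addChar_of_value_at_one_def]
    ring

private lemma prime_dvd_pow_sub_self (x : ℤ_[p]) : (p : ℤ_[p]) ∣ x ^ p - x := by
  rw [← Ideal.mem_span_singleton, ← PadicInt.maximalIdeal_eq_span_p, ← PadicInt.ker_toZMod,
    RingHom.mem_ker]
  simp

private lemma norm_le_of_prime_pow_dvd {x : ℤ_[p]} {n : ℕ} (h : (p : ℤ_[p]) ^ n ∣ x) :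
    ‖x‖ ≤ ((p : ℝ)⁻¹) ^ n := by
  obtain ⟨y, rfl⟩ := h
  rw [norm_mul, norm_pow, PadicInt.norm_p]
  exact mul_le_of_le_one_right (by positivity) y.norm_le_one

/-- The sequence `x^{p^n}` converges for `x ∈ ℤ_p`. -/
lemma exists_tendsto_pow_prime_pow (x : ℤ_[p]) :
    ∃ L : ℤ_[p], Tendsto (fun n : ℕ => x ^ p ^ n) atTop (𝓝 L) ∧ ‖x - L‖ < 1 := by
  have hp1 : (p : ℝ)⁻¹ < 1 := inv_lt_one_of_one_lt₀ (mod_cast (Fact.out : p.Prime).one_lt)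
  have step (n : ℕ) : ‖x ^ p ^ (n + 1) - x ^ p ^ n‖ ≤ ((p : ℝ)⁻¹) ^ (n + 1) := by
    rw [pow_succ' p, pow_mul]
    exact norm_le_of_prime_pow_dvd (dvd_sub_pow_of_dvd_sub (prime_dvd_pow_sub_self x) n)
  obtain ⟨L, hL⟩ := cauchySeq_tendsto_of_complete
    (cauchySeq_of_le_geometric (f := fun n : ℕ => x ^ p ^ n) ((p : ℝ)⁻¹) (p : ℝ)⁻¹ hp1 fun n => by
      rw [dist_comm, dist_eq_norm, ← pow_succ']
      exact step n)
  refine ⟨L, hL, lt_of_le_of_lt ?_ hp1⟩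
  refine le_of_tendsto (tendsto_const_nhds.sub hL).norm (Eventually.of_forall fun n => ?_)
  induction n with
  | zero => simp
  | succ n ih =>
    rw [← sub_add_sub_cancel x (x ^ p ^ n)]
    refine (IsUltrametricDist.norm_add_le_max _ _).trans (max_le ih ?_)
    rw [norm_sub_rev]
    exact (step n).trans (pow_le_of_le_one (by positivity) hp1.le (by simp))

private lemma tendsto_one_add_pow_prime_pow {w : ℤ_[p]} (hw : ‖w‖ < 1) :
    Tendsto (fun n : ℕ => (1 + w) ^ p ^ n) atTop (𝓝 1) := by
  have hp1 : (p : ℝ)⁻¹ < 1 := inv_lt_one_of_one_lt₀ (mod_cast (Fact.out : p.Prime).one_lt)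
  have hd : (p : ℤ_[p]) ∣ (1 + w) - 1 := by
    rw [add_sub_cancel_left]; exact (PadicInt.norm_lt_one_iff_dvd w).1 hw
  rw [tendsto_iff_norm_sub_tendsto_zero]
  refine squeeze_zero (fun _ => norm_nonneg _) (fun n => ?_)
    ((tendsto_pow_atTop_nhds_zero_of_lt_one (by positivity) hp1).comp (tendsto_add_atTop_nat 1))
  simpa using norm_le_of_prime_pow_dvd (dvd_sub_pow_of_dvd_sub hd n)

lemma norm_unitPart {x : ℚ_[p]} (hx : x ≠ 0) : ‖unitPart p x‖ = 1 := by
  have hp0 : (p : ℝ) ≠ 0 := mod_cast (Fact.out : p.Prime).ne_zero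
  rw [unitPart, norm_mul, Padic.norm_eq_zpow_neg_valuation hx, Padic.norm_p_zpow, ← zpow_add₀ hp0]
  simp

lemma tendsto_teich {x : ℚ_[p]} (hx : ‖x‖ = 1) :
    Tendsto (fun n : ℕ => x ^ p ^ n) atTop (𝓝 (teich p x)) ∧ ‖x - teich p x‖ < 1 := by
  obtain ⟨L, hL, hxL⟩ := exists_tendsto_pow_prime_pow (⟨x, hx.le⟩ : ℤ_[p])
  have h : Tendsto (fun n : ℕ => x ^ p ^ n) atTop (𝓝 (L : ℚ_[p])) :=
    (continuous_subtype_val.tendsto L).comp hL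
  rw [teich, h.limUnder_eq]
  exact ⟨h, hxL⟩

lemma norm_angle_sub_one_lt {x : ℚ_[p]} (hx : x ≠ 0) : ‖angle p x - 1‖ < 1 := by
  have hu := norm_unitPart hx
  have ht := (tendsto_teich hu).2
  have hn : ‖teich p (unitPart p x)‖ = 1 := by
    rw [← hu]
    exact (Padic.norm_eq_of_norm_sub_lt_left (by rwa [hu])).symm
  have h0 : teich p (unitPart p x) ≠ 0 := by
    intro h; simp [h] at hn
  rw [angle, div_sub_one h0, norm_div, hn, div_one]
  exact ht

lemma angle_mul_one_add {x w : ℚ_[p]} (hx : x ≠ 0) (hw : ‖w‖ < 1) :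
    angle p (x * (1 + w)) = angle p x * (1 + w) := by
  have hn : ‖1 + w‖ = 1 := by
    rw [← norm_one (α := ℚ_[p])]
    exact Padic.norm_eq_of_norm_sub_lt_right (by simpa using hw)
  have h0 : 1 + w ≠ 0 := by
    intro h; simp [h] at hn
  have hv : (1 + w).valuation = 0 := by
    have := Padic.norm_eq_zpow_neg_valuation h0
    rw [hn] at this
    have h1 : (1 : ℝ) < p := mod_cast (Fact.out : p.Prime).one_lt
    have := (zpow_eq_one_iff_right₀ (by positivity) h1.ne').1 this.symm
    omega
  have hup : unitPart p (x * (1 + w)) = unitPart p x * (1 + w) := by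
    rw [unitPart, unitPart, Padic.valuation_mul hx h0, hv]
    ring_nf
  have hw1 : Tendsto (fun n : ℕ => (1 + w) ^ p ^ n) atTop (𝓝 1) :=
    (continuous_subtype_val.tendsto _).comp
      (tendsto_one_add_pow_prime_pow (w := (⟨w, hw.le⟩ : ℤ_[p])) hw)
  have ht : teich p (unitPart p x * (1 + w)) = teich p (unitPart p x) := by
    have := (tendsto_teich (norm_unitPart hx)).1.mul hw1
    simp only [← mul_pow, mul_one] at this
    exact this.limUnder_eq
  rw [angle, angle, hup, ht]
  ring

end PZeta


open PZeta

/-- shifted power series expansion of the `p`-adic Hurwitz zeta function: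
for `‖λ‖ > 1`, `‖u‖ < ‖λ‖`, all `B_n^f(u) = ∫_{ℤ_p} (u+f(a))^n da` exist,
`Σ_n C(1-s,n) B_n^f(u) λ^{-n}` converges, and
`ζ_p^f(s,λ+u) = (s-1)⁻¹ ⟨λ⟩^{1-s} Σ_n C(1-s,n) B_n^f(u) λ^{-n}`. -/
theorem zetaH_power_series_shifted (p : ℕ) [Fact p.Prime] (hp : Odd p)
    (f : ℤ_[p] → ℤ_[p]) (hf : EverywhereAnalytic p f)
    (lam u : ℚ_[p]) (hlam : 1 < ‖lam‖) (hu : ‖u‖ < ‖lam‖) (s : ℤ_[p]) (hs : s ≠ 1) :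
    ∃ (B : ℕ → ℚ_[p]) (I : ℚ_[p]),
      (∀ n : ℕ, Filter.Tendsto (volkSum p fun a => (u + (f a : ℚ_[p])) ^ n)
        Filter.atTop (nhds (B n))) ∧
      Filter.Tendsto
        (volkSum p fun a => bpow p (angle p (lam + u + (f a : ℚ_[p]))) (1 - (s : ℚ_[p])))
        Filter.atTop (nhds I) ∧
      Summable (fun n : ℕ => gbinom p (1 - (s : ℚ_[p])) n * B n / lam ^ n) ∧
      ((s : ℚ_[p]) - 1)⁻¹ * I =
        ((s : ℚ_[p]) - 1)⁻¹ * bpow p (angle p lam) (1 - (s : ℚ_[p])) *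
          ∑' n : ℕ, gbinom p (1 - (s : ℚ_[p])) n * B n / lam ^ n := by
  obtain ⟨d, hd⟩ := hf.exists_taylorBound
  have hlam0 : lam ≠ 0 := by
    rintro rfl
    simp only [norm_zero] at hlam
    linarith
  set M : ℝ := max 1 ‖u‖
  have hM1 : 1 ≤ M := le_max_left _ _
  have hMlam : M < ‖lam‖ := max_lt hlam hu
  have hlampos : 0 < ‖lam‖ := norm_pos_iff.2 hlam0
  have H := ((TaylorBound.const u).mono (le_max_right 1 ‖u‖)).add (hd.mono hM1)
  choose e He using H.exists_pow
  choose B hB using fun n => (He n).exists_tendsto_volkSum hp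
  obtain ⟨t, ht⟩ : ∃ t : ℤ_[p], (t : ℚ_[p]) = 1 - (s : ℚ_[p]) := ⟨1 - s, by push_cast; rfl⟩
  rw [← ht]
  have hw (a : ℤ_[p]) : ‖(u + (f a : ℚ_[p])) / lam‖ < 1 := by
    rw [norm_div, div_lt_one hlampos]
    exact (H.norm_le a).trans_lt hMlam
  have hbound (N n : ℕ) : ‖gbinom p t n * volkSum p (fun a => (u + (f a : ℚ_[p])) ^ n) N / lam ^ n‖
      ≤ p * (M / ‖lam‖) ^ n := by
    rw [norm_div, norm_mul, norm_pow, div_pow, mul_div_assoc']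
    refine div_le_div_of_nonneg_right ?_ (by positivity)
    calc _ ≤ 1 * (M ^ n * p) :=
          mul_le_mul (norm_gbinom_le_one t n) ((He n).norm_volkSum_le hp N) (norm_nonneg _)
            zero_le_one
      _ = p * M ^ n := by ring
  have hgeom : Summable fun n : ℕ => (p : ℝ) * (M / ‖lam‖) ^ n :=
    (summable_geometric_of_lt_one (by positivity) ((div_lt_one hlampos).2 hMlam)).mul_left _
  have hlim (n : ℕ) : Tendsto
      (fun N => gbinom p t n * volkSum p (fun a => (u + (f a : ℚ_[p])) ^ n) N / lam ^ n) atTop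
      (𝓝 (gbinom p t n * B n / lam ^ n)) := ((hB n).const_mul _).div_const _
  have hsum : Summable fun n : ℕ => gbinom p t n * B n / lam ^ n :=
    hgeom.of_norm_bounded fun n =>
      le_of_tendsto (hlim n).norm (Eventually.of_forall fun N => hbound N n)
  have hterm (a : ℤ_[p]) : bpow p (angle p (lam + u + (f a : ℚ_[p]))) t =
      bpow p (angle p lam) t * ∑' n, gbinom p t n * (u + (f a : ℚ_[p])) ^ n / lam ^ n := by
    have e1 : lam + u + (f a : ℚ_[p]) = lam * (1 + (u + f a) / lam) := by
      field_simp
      ring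
    rw [e1, angle_mul_one_add hlam0 (hw a),
      bpow_mul (norm_angle_sub_one_lt hlam0) (by simpa using hw a)]
    congr 1
    refine tsum_congr fun n => ?_
    rw [add_sub_cancel_left, div_pow, mul_div_assoc]
  have hsumterm (a : ℤ_[p]) : Summable fun n => gbinom p t n * (u + (f a : ℚ_[p])) ^ n / lam ^ n := by
    refine (summable_geometric_of_lt_one (norm_nonneg _) (hw a)).of_norm_bounded fun n => ?_
    rw [mul_div_assoc, ← div_pow, norm_mul, norm_pow]
    exact mul_le_of_le_one_left (by positivity) (norm_gbinom_le_one t n)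
  have hvolk (N : ℕ) : volkSum p (fun a => bpow p (angle p (lam + u + (f a : ℚ_[p]))) t) N =
      bpow p (angle p lam) t *
        ∑' n, gbinom p t n * volkSum p (fun a => (u + (f a : ℚ_[p])) ^ n) N / lam ^ n := by
    simp only [volkSum, hterm]
    rw [← Finset.mul_sum, ← Summable.tsum_finsetSum fun (a : ℕ) _ => hsumterm (a : ℤ_[p]), mul_left_comm,
      ← tsum_mul_left]
    congr 1
    refine tsum_congr fun n => ?_
    rw [← Finset.sum_div, ← Finset.mul_sum]
    ring
  refine ⟨B, bpow p (angle p lam) t * ∑' n, gbinom p t n * B n / lam ^ n, hB, ?_, hsum, ?_⟩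
  · refine Tendsto.congr (fun N => (hvolk N).symm) (Tendsto.const_mul _ ?_)
    exact tendsto_tsum_of_dominated_convergence hgeom hlim
      (Eventually.of_forall fun N n => hbound N n)
  · rw [mul_assoc]
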